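/- arXiv:1107.5608 — 2 statements merged into one kernel-verified Lean document; each statement's English description precedes it below -/
import Mathlib

section
/- Let b = 200526827. The 20-tuple (164·165, (164·165)², 164, 165, 132, 133, 132·133, (132·133)², 143, 144, 143·144, (143·144)², 132·133·143·144, b, 2b, 2b−1, 3b−1, (2b−1)(3b−1), 667378345, 1), where 667378345 = (2b−1)(3b−1)/(132·133·143·144), belongs to B₂₀(ℤ) if and only if every integer triple (x,y,z) satisfying x²(x+1)² + y²(y+1)² = z²(z+1)² and x(x+1)·y(y+1) ≠ 0 belongs to ({−133,132} × {−144,143} × {−165,164}) ∪ ({−144,143} × {−133,132} × {−165,164}). -/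
/-- `B_n(ℤ)`: the set of `n`-tuples of integers `x` such that for every
`n`-tuple of integers `y`, if the three implication conditions hold then `x₁ = y₁`. -/
def BInt (n : ℕ) [NeZero n] (x : Fin n → ℤ) : Prop :=
  ∀ y : Fin n → ℤ,
    ((∀ i, x i = 1 → y i = 1) ∧
     (∀ i j k, x i + x j = x k → y i + y j = y k) ∧
     (∀ i j k, x i * x j = x k → y i * y j = y k)) →
    x 0 = y 0
/-- The congruence `(2b - 1)(3b - 1) ≡ 0` is solvable modulo every nonzero integer. -/
theorem exists_dvd_two_mul_sub_one_mul_three_mul_sub_one {n : ℤ} (hn : n ≠ 0) :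
    ∃ b : ℤ, n ∣ (2 * b - 1) * (3 * b - 1) := by
  obtain ⟨a, m, hm, h⟩ := Nat.exists_eq_two_pow_mul_odd (Int.natAbs_ne_zero.mpr hn)
  obtain ⟨k, rfl⟩ := hm
  have hc : IsCoprime (3 * (2 * k + 1) : ℤ) (2 ^ a) := by
    refine IsCoprime.pow_right ⟨1, -(3 * k + 1), ?_⟩
    ring
  obtain ⟨u, v, huv⟩ := hc
  refine ⟨-k + (2 * k + 1) * (u * (3 * k + 1)), ?_⟩
  rw [← Int.natAbs_dvd, h]
  push_cast
  rw [mul_comm ((2 : ℤ) ^ a)]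
  refine mul_dvd_mul ⟨2 * (u * (3 * k + 1)) - 1, by ring⟩ ⟨-(v * (3 * k + 1)), ?_⟩
  linear_combination (3 * k + 1 : ℤ) * huv

theorem nat_pronic_sq_add_sq_eq :
    ∀ p < 165, ∀ q < 165, (p * (p + 1)) ^ 2 + (q * (q + 1)) ^ 2 = 27060 ^ 2 →
      p = 0 ∨ q = 0 ∨ (p = 132 ∧ q = 143) ∨ (p = 143 ∧ q = 132) := by
  decide +kernel

/-- Every pronic integer is `p * (p + 1)` for a natural number `p`. -/
theorem exists_nat_pronic (x : ℤ) :
    ∃ p : ℕ, (x = p ∨ x = -1 - p) ∧ x * (x + 1) = p * (p + 1) := by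
  rcases le_or_gt 0 x with h | h
  · exact ⟨x.toNat, by omega, by rw [Int.toNat_of_nonneg h]⟩
  · refine ⟨(-1 - x).toNat, by omega, ?_⟩
    rw [Int.toNat_of_nonneg (by omega)]
    ring

theorem int_pronic_sq_add_sq_eq {x y : ℤ}
    (h : (x * (x + 1)) ^ 2 + (y * (y + 1)) ^ 2 = 27060 ^ 2)
    (hx : x * (x + 1) ≠ 0) (hy : y * (y + 1) ≠ 0) :
    ((x = -133 ∨ x = 132) ∧ (y = -144 ∨ y = 143)) ∨
      ((x = -144 ∨ x = 143) ∧ (y = -133 ∨ y = 132)) := by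
  obtain ⟨p, hp, hxp⟩ := exists_nat_pronic x
  obtain ⟨q, hq, hyq⟩ := exists_nat_pronic y
  rw [hxp] at h hx
  rw [hyq] at h hy
  have h' : (p * (p + 1)) ^ 2 + (q * (q + 1)) ^ 2 = 27060 ^ 2 := by exact_mod_cast h
  have bound : ∀ r : ℕ, (r * (r + 1)) ^ 2 ≤ 27060 ^ 2 → r < 165 := by
    intro r hr
    have := (Nat.pow_le_pow_iff_left two_ne_zero).mp hr
    nlinarith
  have hp0 : p ≠ 0 := by rintro rfl; simp at hx
  have hq0 : q ≠ 0 := by rintro rfl; simp at hy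
  have := nat_pronic_sq_add_sq_eq p (bound p (by omega)) q (bound q (by omega)) h'
  omega

theorem stmt_5 :
    BInt 20 ![164 * 165, (164 * 165) ^ 2, 164, 165,
              132, 133, 132 * 133, (132 * 133) ^ 2,
              143, 144, 143 * 144, (143 * 144) ^ 2, 132 * 133 * 143 * 144,
              200526827, 2 * 200526827, 2 * 200526827 - 1, 3 * 200526827 - 1,
              (2 * 200526827 - 1) * (3 * 200526827 - 1), 667378345, 1] ↔
    (∀ x y z : ℤ,
      x ^ 2 * (x + 1) ^ 2 + y ^ 2 * (y + 1) ^ 2 = z ^ 2 * (z + 1) ^ 2 →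
      x * (x + 1) * y * (y + 1) ≠ 0 →
      ((x = -133 ∨ x = 132) ∧ (y = -144 ∨ y = 143) ∧ (z = -165 ∨ z = 164)) ∨
      ((x = -144 ∨ x = 143) ∧ (y = -133 ∨ y = 132) ∧ (z = -165 ∨ z = 164))) := by
  constructor
  · intro H x y z h hne
    obtain ⟨b, c, hc⟩ := exists_dvd_two_mul_sub_one_mul_three_mul_sub_one hne
    have key := H ![z * (z + 1), (z * (z + 1)) ^ 2, z, z + 1,
      x, x + 1, x * (x + 1), (x * (x + 1)) ^ 2,
      y, y + 1, y * (y + 1), (y * (y + 1)) ^ 2, x * (x + 1) * y * (y + 1),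
      b, 2 * b, 2 * b - 1, 3 * b - 1, (2 * b - 1) * (3 * b - 1), c, 1] ?_
    · have hz : z * (z + 1) = 27060 := by simpa using key.symm
      have hz' : z = -165 ∨ z = 164 := by
        have : (z + 165) * (z - 164) = 0 := by linear_combination hz
        rcases mul_eq_zero.mp this with h | h <;> omega
      have hx : x * (x + 1) ≠ 0 := fun h0 => hne (by rw [h0]; ring)
      have hy : y * (y + 1) ≠ 0 := fun h0 => hne (by rw [mul_assoc, h0]; ring)
      have hxy := int_pronic_sq_add_sq_eq (x := x) (y := y)
        (by linear_combination h + (z * (z + 1) + 27060) * hz) hx hy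
      tauto
    · refine ⟨?_, ?_, ?_⟩
      · intro i hi
        have : i = 19 := by
          revert i
          decide +kernel
        subst this
        rfl
      · intro i j k hijk
        have : (i, j, k) ∈ ([(2, 19, 3), (4, 19, 5), (7, 11, 1), (8, 19, 9), (11, 7, 1),
            (13, 13, 14), (13, 15, 16), (15, 13, 16), (15, 19, 14), (19, 2, 3), (19, 4, 5),
            (19, 8, 9), (19, 15, 14)] : List (Fin 20 × Fin 20 × Fin 20)) := by
          revert i j k
          decide +kernel
        simp only [List.mem_cons, Prod.mk.injEq, List.not_mem_nil, or_false] at this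
        rcases this with ⟨rfl, rfl, rfl⟩ | ⟨rfl, rfl, rfl⟩ | ⟨rfl, rfl, rfl⟩ | ⟨rfl, rfl, rfl⟩ |
          ⟨rfl, rfl, rfl⟩ | ⟨rfl, rfl, rfl⟩ | ⟨rfl, rfl, rfl⟩ | ⟨rfl, rfl, rfl⟩ |
          ⟨rfl, rfl, rfl⟩ | ⟨rfl, rfl, rfl⟩ | ⟨rfl, rfl, rfl⟩ | ⟨rfl, rfl, rfl⟩ |
          ⟨rfl, rfl, rfl⟩ <;> clear hijk <;> simp <;> first | ring1 | linear_combination h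
      · intro i j k hijk
        have : (i = 19 ∧ j = k) ∨ (j = 19 ∧ i = k) ∨
            (i, j, k) ∈ ([(0, 0, 1), (2, 3, 0), (3, 2, 0), (4, 5, 6), (5, 4, 6), (6, 6, 7),
            (6, 10, 12), (8, 9, 10), (9, 8, 10), (10, 6, 12), (10, 10, 11), (12, 18, 17),
            (15, 16, 17), (16, 15, 17), (18, 12, 17)] : List (Fin 20 × Fin 20 × Fin 20)) := by
          revert i j k
          decide +kernel
        simp only [List.mem_cons, Prod.mk.injEq, List.not_mem_nil, or_false] at this
        rcases this with ⟨rfl, rfl⟩ | ⟨rfl, rfl⟩ | ⟨rfl, rfl, rfl⟩ | ⟨rfl, rfl, rfl⟩ |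
          ⟨rfl, rfl, rfl⟩ | ⟨rfl, rfl, rfl⟩ | ⟨rfl, rfl, rfl⟩ | ⟨rfl, rfl, rfl⟩ |
          ⟨rfl, rfl, rfl⟩ | ⟨rfl, rfl, rfl⟩ | ⟨rfl, rfl, rfl⟩ | ⟨rfl, rfl, rfl⟩ |
          ⟨rfl, rfl, rfl⟩ | ⟨rfl, rfl, rfl⟩ | ⟨rfl, rfl, rfl⟩ | ⟨rfl, rfl, rfl⟩ |
          ⟨rfl, rfl, rfl⟩
        · exact one_mul _
        · exact mul_one _
        all_goals
          clear hijk
          dsimp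
        all_goals first | ring1 | linear_combination hc | linear_combination -hc
  · rintro H y ⟨hone, hadd, hmul⟩
    have h19 : y 19 = 1 := hone 19 rfl
    have a3 : y 2 + y 19 = y 3 := hadd 2 19 3 (by decide +kernel)
    have a5 : y 4 + y 19 = y 5 := hadd 4 19 5 (by decide +kernel)
    have a9 : y 8 + y 19 = y 9 := hadd 8 19 9 (by decide +kernel)
    have a1 : y 7 + y 11 = y 1 := hadd 7 11 1 (by decide +kernel)
    have a14 : y 13 + y 13 = y 14 := hadd 13 13 14 (by decide +kernel)
    have a15 : y 15 + y 19 = y 14 := hadd 15 19 14 (by decide +kernel)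
    have a16 : y 13 + y 15 = y 16 := hadd 13 15 16 (by decide +kernel)
    have m0 : y 2 * y 3 = y 0 := hmul 2 3 0 (by decide +kernel)
    have m1 : y 0 * y 0 = y 1 := hmul 0 0 1 (by decide +kernel)
    have m6 : y 4 * y 5 = y 6 := hmul 4 5 6 (by decide +kernel)
    have m7 : y 6 * y 6 = y 7 := hmul 6 6 7 (by decide +kernel)
    have m10 : y 8 * y 9 = y 10 := hmul 8 9 10 (by decide +kernel)
    have m11 : y 10 * y 10 = y 11 := hmul 10 10 11 (by decide +kernel)
    have m12 : y 6 * y 10 = y 12 := hmul 6 10 12 (by decide +kernel)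
    have m17 : y 15 * y 16 = y 17 := hmul 15 16 17 (by decide +kernel)
    have m17' : y 12 * y 18 = y 17 := hmul 12 18 17 (by decide +kernel)
    rw [h19] at a3 a5 a9 a15
    rw [← a3] at m0
    rw [← a5] at m6
    rw [← a9] at m10
    have hz : y 2 = -165 ∨ y 2 = 164 := by
      have := H (y 4) (y 8) (y 2) ?_ ?_
      · tauto
      · rw [← m0, ← a1, ← m7, ← m11, ← m6, ← m10] at m1
        linear_combination -m1
      · intro h0
        have h12 : y 12 = 0 := by
          rw [← m12, ← m6, ← m10]
          linear_combination h0
        rw [h12, zero_mul, ← m17] at m17'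
        rcases mul_eq_zero.mp m17'.symm with h | h <;> omega
    show (164 * 165 : ℤ) = y 0
    rw [← m0]
    rcases hz with h | h <;> rw [h] <;> norm_num
end

section
/- The 17-tuple (328, 330, 328·330, (328·330)², 264, 266, 264·266, (264·266)², 286, 288, 286·288, (286·288)², 250, 16, 4, 2, 1) belongs to B₁₇(ℕ∖{0}) if and only if the only triples (x,y,z) of positive integers satisfying (x+14)²(x+16)² + y²(y+2)² = z²(z+2)² are (250, 286, 328) and (272, 264, 328). -/
/-- `B_n(ℕ∖{0})`: the set of `n`-tuples of positive natural numbers `x` such that for every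
`n`-tuple of positive natural numbers `y`, if the three implication conditions hold then
`x₁ = y₁`. -/
def BPos (n : ℕ) [NeZero n] (x : Fin n → ℕ) : Prop :=
  (∀ i, 0 < x i) ∧
  ∀ y : Fin n → ℕ, (∀ i, 0 < y i) →
    ((∀ i, x i = 1 → y i = 1) ∧
     (∀ i j k, x i + x j = x k → y i + y j = y k) ∧
     (∀ i j k, x i * x j = x k → y i * y j = y k)) →
    x 0 = y 0

/-- The 17-tuple of the statement. -/
abbrev seventeenTuple : Fin 17 → ℕ :=
  ![328, 330, 328 * 330, (328 * 330) ^ 2,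
    264, 266, 264 * 266, (264 * 266) ^ 2,
    286, 288, 286 * 288, (286 * 288) ^ 2,
    250, 16, 4, 2, 1]

theorem seventeenTuple_eq_one : ∀ i, seventeenTuple i = 1 → i = 16 := by
  decide +kernel

theorem seventeenTuple_add : ∀ i j k, seventeenTuple i + seventeenTuple j = seventeenTuple k →
    (i, j, k) ∈ ([(0, 15, 1), (15, 0, 1), (4, 15, 5), (15, 4, 5), (8, 15, 9), (15, 8, 9),
      (7, 11, 3), (11, 7, 3), (12, 13, 5), (13, 12, 5), (15, 15, 14), (16, 16, 15)] :
      List (Fin 17 × Fin 17 × Fin 17)) := by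
  decide +kernel

theorem seventeenTuple_mul : ∀ i j k, seventeenTuple i * seventeenTuple j = seventeenTuple k →
    (i = 16 ∧ j = k) ∨ (j = 16 ∧ i = k) ∨
    (i, j, k) ∈ ([(0, 1, 2), (1, 0, 2), (2, 2, 3), (4, 5, 6), (5, 4, 6), (6, 6, 7),
      (8, 9, 10), (9, 8, 10), (10, 10, 11), (14, 14, 13), (15, 15, 14)] :
      List (Fin 17 × Fin 17 × Fin 17)) := by
  decide +kernel

/-- The positive solutions with `z = 328`, where `(328 * 330) ^ 2 = 11715897600`. -/
theorem solutions_of_lt : ∀ x y : Fin 330, 0 < x.val → 0 < y.val →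
    (x.val + 14) ^ 2 * (x.val + 16) ^ 2 + y.val ^ 2 * (y.val + 2) ^ 2 = 11715897600 →
    (x.val = 250 ∧ y.val = 286) ∨ (x.val = 272 ∧ y.val = 264) := by
  decide +kernel

theorem solutions_of_eq {x y : ℕ} (hx : 0 < x) (hy : 0 < y)
    (h : (x + 14) ^ 2 * (x + 16) ^ 2 + y ^ 2 * (y + 2) ^ 2 = 328 ^ 2 * (328 + 2) ^ 2) :
    (x = 250 ∧ y = 286) ∨ (x = 272 ∧ y = 264) := by
  norm_num at h
  refine solutions_of_lt ⟨x, ?_⟩ ⟨y, ?_⟩ hx hy h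
  · by_contra! hle
    have : (330 + 14) ^ 2 * (330 + 16) ^ 2 ≤ (x + 14) ^ 2 * (x + 16) ^ 2 := by gcongr
    omega
  · by_contra! hle
    have : 330 ^ 2 * (330 + 2) ^ 2 ≤ y ^ 2 * (y + 2) ^ 2 := by gcongr
    omega

/-- The tuple built from a solution `(x, y, z)`. -/
abbrev solutionTuple (x y z : ℕ) : Fin 17 → ℕ :=
  ![z, z + 2, z * (z + 2), (z * (z + 2)) ^ 2,
    x + 14, x + 16, (x + 14) * (x + 16), ((x + 14) * (x + 16)) ^ 2,
    y, y + 2, y * (y + 2), (y * (y + 2)) ^ 2,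
    x, 16, 4, 2, 1]

theorem solutionTuple_pos {x y z : ℕ} (hx : 0 < x) (hy : 0 < y) (hz : 0 < z) (i : Fin 17) :
    0 < solutionTuple x y z i := by
  fin_cases i <;> simp [solutionTuple, hx, hy, hz]

theorem solutionTuple_add {x y z : ℕ}
    (h : (x + 14) ^ 2 * (x + 16) ^ 2 + y ^ 2 * (y + 2) ^ 2 = z ^ 2 * (z + 2) ^ 2)
    (i j k : Fin 17) (hijk : seventeenTuple i + seventeenTuple j = seventeenTuple k) :
    solutionTuple x y z i + solutionTuple x y z j = solutionTuple x y z k := by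
  have hmem := seventeenTuple_add i j k hijk
  clear hijk
  simp only [List.mem_cons, List.not_mem_nil, or_false, Prod.mk.injEq] at hmem
  rcases hmem with ⟨rfl, rfl, rfl⟩ | ⟨rfl, rfl, rfl⟩ | ⟨rfl, rfl, rfl⟩ | ⟨rfl, rfl, rfl⟩ |
    ⟨rfl, rfl, rfl⟩ | ⟨rfl, rfl, rfl⟩ | ⟨rfl, rfl, rfl⟩ | ⟨rfl, rfl, rfl⟩ | ⟨rfl, rfl, rfl⟩ |
    ⟨rfl, rfl, rfl⟩ | ⟨rfl, rfl, rfl⟩ | ⟨rfl, rfl, rfl⟩ <;>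
    simp [solutionTuple, mul_pow] <;> omega

theorem solutionTuple_mul {x y z : ℕ}
    (i j k : Fin 17) (hijk : seventeenTuple i * seventeenTuple j = seventeenTuple k) :
    solutionTuple x y z i * solutionTuple x y z j = solutionTuple x y z k := by
  have hmem := seventeenTuple_mul i j k hijk
  clear hijk
  simp only [List.mem_cons, List.not_mem_nil, or_false, Prod.mk.injEq] at hmem
  have h16 : solutionTuple x y z 16 = 1 := rfl
  rcases hmem with ⟨rfl, rfl⟩ | ⟨rfl, rfl⟩ | hmem
  · rw [h16, one_mul]
  · rw [h16, mul_one]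
  · rcases hmem with ⟨rfl, rfl, rfl⟩ | ⟨rfl, rfl, rfl⟩ | ⟨rfl, rfl, rfl⟩ | ⟨rfl, rfl, rfl⟩ |
      ⟨rfl, rfl, rfl⟩ | ⟨rfl, rfl, rfl⟩ | ⟨rfl, rfl, rfl⟩ | ⟨rfl, rfl, rfl⟩ | ⟨rfl, rfl, rfl⟩ |
      ⟨rfl, rfl, rfl⟩ | ⟨rfl, rfl, rfl⟩ <;>
      simp [solutionTuple] <;> ring

theorem stmt_6 :
    BPos 17 ![328, 330, 328 * 330, (328 * 330) ^ 2,
              264, 266, 264 * 266, (264 * 266) ^ 2,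
              286, 288, 286 * 288, (286 * 288) ^ 2,
              250, 16, 4, 2, 1] ↔
    (∀ x y z : ℕ, 0 < x → 0 < y → 0 < z →
      (x + 14) ^ 2 * (x + 16) ^ 2 + y ^ 2 * (y + 2) ^ 2 = z ^ 2 * (z + 2) ^ 2 →
      (x = 250 ∧ y = 286 ∧ z = 328) ∨ (x = 272 ∧ y = 264 ∧ z = 328)) := by
  change BPos 17 seventeenTuple ↔ _
  constructor
  · rintro ⟨-, hB⟩ x y z hx hy hz h
    have hz' : 328 = z := hB (solutionTuple x y z) (solutionTuple_pos hx hy hz)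
      ⟨fun i hi => by rw [seventeenTuple_eq_one i hi]; rfl,
        solutionTuple_add h, solutionTuple_mul⟩
    subst hz'
    simpa using solutions_of_eq hx hy h
  · intro H
    refine ⟨by decide +kernel, fun y hy ⟨hone, hadd, hmul⟩ => ?_⟩
    have h16 := hone 16 (by decide +kernel)
    have h15 := hadd 16 16 15 (by decide +kernel)
    have h14 := hadd 15 15 14 (by decide +kernel)
    have h13 := hmul 14 14 13 (by decide +kernel)
    have h1 := hadd 0 15 1 (by decide +kernel)
    have h5 := hadd 4 15 5 (by decide +kernel)
    have h9 := hadd 8 15 9 (by decide +kernel)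
    have h5' := hadd 12 13 5 (by decide +kernel)
    have h2 := hmul 0 1 2 (by decide +kernel)
    have h3 := hmul 2 2 3 (by decide +kernel)
    have h6 := hmul 4 5 6 (by decide +kernel)
    have h7 := hmul 6 6 7 (by decide +kernel)
    have h10 := hmul 8 9 10 (by decide +kernel)
    have h11 := hmul 10 10 11 (by decide +kernel)
    have hsum := hadd 7 11 3 (by decide +kernel)
    have e15 : y 15 = 2 := by omega
    have e14 : y 14 = 4 := by omega
    have e13 : y 13 = 16 := by rw [← h13, e14]
    have e1 : y 1 = y 0 + 2 := by omega
    have e5 : y 5 = y 12 + 16 := by omega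
    have e4 : y 4 = y 12 + 14 := by omega
    have e9 : y 9 = y 8 + 2 := by omega
    rw [← h7, ← h6, ← h11, ← h10, ← h3, ← h2, e1, e4, e5, e9] at hsum
    have hz : y 0 = 328 := by
      rcases H (y 12) (y 8) (y 0) (hy _) (hy _) (hy _) (by linarith) with h | h
      · exact h.2.2
      · exact h.2.2
    exact hz.symm
end
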